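/- arXiv:0807.1081 — 2 statements merged into one kernel-verified Lean document; each statement's English description precedes it below -/
import Mathlib

section
/- The Borwein cubic theta function equals the weight-1 Eisenstein series with character χ₋₃: for all τ in the upper half-plane, ∑_{n,m∈ℤ} q^{n²+nm+m²} = 1 + 6·∑_{n≥1} (∑_{d∣n} χ₋₃(d)) qⁿ, where q = exp(2πiτ). -/
open Complex

noncomputable section

/-- q = exp(2πiτ). -/
def qq (τ : ℂ) : ℂ := Complex.exp (2 * Real.pi * Complex.I * τ)

/-- The Borwein cubic theta function 𝒜₃(τ) = ∑_{n,m∈ℤ} q^{n²+nm+m²}. -/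
def A3 (τ : ℂ) : ℂ := ∑' p : ℤ × ℤ, qq τ ^ (p.1 ^ 2 + p.1 * p.2 + p.2 ^ 2)

/-- The quadratic character χ₋₃ (on natural numbers). -/
def chiNeg3 (d : ℕ) : ℂ := if d % 3 = 1 then 1 else if d % 3 = 2 then -1 else 0

namespace BCT

/-- Integer valued character. -/
def chi (d : ℕ) : ℤ := if d % 3 = 1 then 1 else if d % 3 = 2 then -1 else 0

lemma chi_mul (a b : ℕ) : chi (a * b) = chi a * chi b := by
  have ha : a % 3 < 3 := Nat.mod_lt _ (by norm_num)
  have hb : b % 3 < 3 := Nat.mod_lt _ (by norm_num)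
  unfold chi
  rw [Nat.mul_mod]
  generalize a % 3 = x at *
  generalize b % 3 = y at *
  interval_cases x <;> interval_cases y <;> simp

/-- Divisor sum. -/
def c (n : ℕ) : ℤ := ∑ d ∈ n.divisors, chi d

lemma c_rec (p n : ℕ) (hp : p.Prime) (hn : 0 < n) :
    c (p * n) = (1 + chi p) * c n - chi p * (if p ∣ n then c (n / p) else 0) := by
  classical
  have hp0 := hp.pos
  have hinj : Function.Injective (fun d : ℕ => p * d) := fun x y h => by
    simpa [hp0.ne'] using h
  have h1 : (p * n).divisors = n.divisors ∪ n.divisors.image (fun d => p * d) := by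
    ext d
    simp only [Finset.mem_union, Finset.mem_image, Nat.mem_divisors]
    constructor
    · rintro ⟨h, -⟩
      by_cases hpd : p ∣ d
      · obtain ⟨e, rfl⟩ := hpd
        exact Or.inr ⟨e, ⟨Nat.dvd_of_mul_dvd_mul_left hp0 h, hn.ne'⟩, rfl⟩
      · left
        exact ⟨(Nat.Coprime.dvd_mul_left ((Nat.Prime.coprime_iff_not_dvd hp).2 hpd).symm).1 h, hn.ne'⟩
    · rintro (⟨h, -⟩ | ⟨e, ⟨h, -⟩, rfl⟩)
      · exact ⟨h.mul_left p, by positivity⟩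
      · exact ⟨Nat.mul_dvd_mul_left p h, by positivity⟩
  have h2 : n.divisors ∩ n.divisors.image (fun d => p * d) =
      if p ∣ n then (n / p).divisors.image (fun d => p * d) else ∅ := by
    split_ifs with hpn
    · obtain ⟨k, rfl⟩ := hpn
      have hk : 0 < k := Nat.pos_of_mul_pos_left hn
      rw [Nat.mul_div_cancel_left _ hp0]
      ext d
      simp only [Finset.mem_inter, Finset.mem_image, Nat.mem_divisors]
      constructor
      · rintro ⟨⟨h, -⟩, e, ⟨h', -⟩, rfl⟩
        exact ⟨e, ⟨Nat.dvd_of_mul_dvd_mul_left hp0 h, hk.ne'⟩, rfl⟩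
      · rintro ⟨e, ⟨h, -⟩, rfl⟩
        exact ⟨⟨Nat.mul_dvd_mul_left p h, hn.ne'⟩, e, ⟨h.mul_left p, hn.ne'⟩, rfl⟩
    · ext d
      simp only [Finset.mem_inter, Finset.mem_image, Nat.mem_divisors, Finset.notMem_empty, iff_false]
      rintro ⟨⟨h, -⟩, e, ⟨h', -⟩, rfl⟩
      exact hpn ((Dvd.intro _ rfl).trans h)
  have h3 : ∀ s : Finset ℕ, ∑ d ∈ s.image (fun d => p * d), chi d = chi p * ∑ d ∈ s, chi d := by
    intro s
    rw [Finset.sum_image (fun x _ y _ h => hinj h), Finset.mul_sum]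
    exact Finset.sum_congr rfl fun d _ => chi_mul p d
  have h4 := Finset.sum_union_inter (s₁ := n.divisors) (s₂ := n.divisors.image (fun d => p * d)) (f := chi)
  rw [← h1, h2, h3] at h4
  unfold c
  split_ifs at h4 ⊢
  · rw [h3] at h4; linarith
  · simp only [Finset.sum_empty] at h4; linarith

/-- The form. -/
def Q (x : ℤ × ℤ) : ℤ := x.1 ^ 2 + x.1 * x.2 + x.2 ^ 2

lemma Q_nonneg (x : ℤ × ℤ) : 0 ≤ Q x := by
  unfold Q; nlinarith [sq_nonneg (x.1 + x.2), sq_nonneg x.1, sq_nonneg x.2]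

/-- Level sets. -/
def S (N : ℕ) : Set (ℤ × ℤ) := {x | Q x = N}

lemma S_finite (N : ℕ) : (S N).Finite := by
  refine ((Set.finite_Icc (-(2 * N : ℤ)) (2 * N)).prod (Set.finite_Icc (-(2 * N : ℤ)) (2 * N))).subset ?_
  rintro ⟨x, y⟩ h
  simp only [S, Q, Set.mem_ofPred_eq] at h
  have hx : x ^ 2 ≤ 2 * N := by nlinarith [sq_nonneg (x + y), sq_nonneg y]
  have hy : y ^ 2 ≤ 2 * N := by nlinarith [sq_nonneg (x + y), sq_nonneg x]
  simp only [Set.mem_prod, Set.mem_Icc]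
  refine ⟨⟨?_, ?_⟩, ?_, ?_⟩ <;> nlinarith [Int.le_self_sq x, Int.le_self_sq y, Int.le_self_sq (-x), Int.le_self_sq (-y)]

/-- Representation numbers. -/
def r (N : ℕ) : ℕ := (S N).ncard

lemma count_mul (a b : ℤ) (p n : ℕ) (hp : 0 < p) (hab : a ^ 2 + a * b + b ^ 2 = p) :
    {x ∈ S (p * n) | (p : ℤ) ∣ x.2 * a - x.1 * b ∧ (p : ℤ) ∣ x.1 * a + x.1 * b + x.2 * b}.ncard = r n := by
  have hp' : (p : ℤ) ≠ 0 := by positivity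
  symm
  refine Set.ncard_congr (fun x _ => (x.1 * a - x.2 * b, x.1 * b + x.2 * a + x.2 * b)) ?_ ?_ ?_
  · rintro ⟨x, y⟩ h
    simp only [S, Q, Set.mem_ofPred_eq] at h ⊢
    push_cast
    refine ⟨?_, ⟨y, ?_⟩, ⟨x, ?_⟩⟩
    · rw [← h, ← hab]; ring
    · rw [← hab]; ring
    · rw [← hab]; ring
  · rintro ⟨x, y⟩ ⟨x', y'⟩ h h' e
    simp only [Prod.mk.injEq] at e ⊢
    obtain ⟨e1, e2⟩ := e
    constructor
    · apply mul_left_cancel₀ hp'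
      rw [← hab]; linear_combination (a + b) * e1 + b * e2
    · apply mul_left_cancel₀ hp'
      rw [← hab]; linear_combination (-b) * e1 + a * e2
  · rintro ⟨x, y⟩ ⟨h, ⟨v, hv⟩, ⟨u, hu⟩⟩
    simp only [S, Q, Set.mem_ofPred_eq] at h hu hv ⊢
    push_cast at h
    have e1 : x = u * a - v * b := by
      apply mul_left_cancel₀ hp'
      linear_combination a * hu - b * hv - x * hab
    have e2 : y = u * b + v * a + v * b := by
      apply mul_left_cancel₀ hp'
      linear_combination b * hu + (a + b) * hv - y * hab
    refine ⟨(u, v), ?_, ?_⟩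
    · apply mul_left_cancel₀ hp'
      rw [← h, e1, e2, ← hab]; ring
    · rw [e1, e2]

lemma count_p (p n : ℕ) (hp : p.Prime) :
    {x ∈ S (p * n) | (p : ℤ) ∣ x.1 ∧ (p : ℤ) ∣ x.2}.ncard = if p ∣ n then r (n / p) else 0 := by
  have hp' : (p : ℤ) ≠ 0 := by exact_mod_cast hp.ne_zero
  split_ifs with h
  · obtain ⟨k, rfl⟩ := h
    rw [Nat.mul_div_cancel_left _ hp.pos]
    symm
    refine Set.ncard_congr (fun x _ => (p * x.1, p * x.2)) ?_ ?_ ?_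
    · rintro ⟨x, y⟩ h
      simp only [S, Q, Set.mem_ofPred_eq] at h ⊢
      push_cast
      refine ⟨?_, ⟨x, rfl⟩, ⟨y, rfl⟩⟩
      rw [← h]; ring
    · rintro ⟨x, y⟩ ⟨x', y'⟩ h h' e
      simp only [Prod.mk.injEq] at e ⊢
      exact ⟨mul_left_cancel₀ hp' e.1, mul_left_cancel₀ hp' e.2⟩
    · rintro ⟨x, y⟩ ⟨h, ⟨u, hu⟩, ⟨v, hv⟩⟩
      simp only [S, Q, Set.mem_ofPred_eq] at h hu hv ⊢
      push_cast at h
      subst hu hv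
      refine ⟨(u, v), ?_, rfl⟩
      apply mul_left_cancel₀ hp'
      apply mul_left_cancel₀ hp'
      rw [← h]; ring
  · rw [Set.ncard_eq_zero ((S_finite _).subset (Set.sep_subset _ _))]
    ext ⟨x, y⟩
    simp only [S, Q, Set.mem_ofPred_eq, Set.mem_empty_iff_false, iff_false]
    rintro ⟨h1, ⟨u, hu⟩, ⟨v, hv⟩⟩
    apply h
    subst hu hv
    push_cast at h1
    have : (p : ℤ) ∣ n := ⟨u ^ 2 + u * v + v ^ 2, by
      apply mul_left_cancel₀ hp'
      rw [← h1]; ring⟩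
    exact_mod_cast this

lemma r_three (n : ℕ) : r (3 * n) = r n := by
  rw [← count_mul 1 1 3 n (by norm_num) (by norm_num)]
  unfold r
  congr 1
  ext ⟨x, y⟩
  simp only [S, Q, Set.mem_ofPred_eq]
  constructor
  · intro h
    refine ⟨h, ?_⟩
    push_cast at h ⊢
    have h3 : (3 : ℤ) ∣ (y - x) ^ 2 := ⟨n - x * y, by linear_combination h⟩
    have := Int.prime_three.dvd_of_dvd_pow h3
    omega
  · exact fun h => h.1

lemma r_two (p n : ℕ) (hp : p.Prime) (h2 : p % 3 = 2) :
    r (p * n) = if p ∣ n then r (n / p) else 0 := by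
  rw [← count_p p n hp]
  unfold r
  congr 1
  ext ⟨x, y⟩
  simp only [S, Q, Set.mem_ofPred_eq]
  refine ⟨fun h => ⟨h, ?_⟩, fun h => h.1⟩
  have := Fact.mk hp
  have hz : (x : ZMod p) ^ 2 + x * y + y ^ 2 = 0 := by
    have := congrArg (Int.cast : ℤ → ZMod p) h
    push_cast at this
    simpa using this
  have hy : (y : ZMod p) = 0 := by
    by_contra hy
    set t : ZMod p := x / y with ht
    have hx : (x : ZMod p) = t * y := by rw [ht]; field_simp
    have hq : t ^ 2 + t + 1 = 0 := by
      have : (t ^ 2 + t + 1) * (y : ZMod p) ^ 2 = 0 := by rw [← hz, hx]; ring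
      rcases mul_eq_zero.1 this with h | h
      · exact h
      · exact absurd (pow_eq_zero_iff (two_ne_zero) |>.1 h) hy
    have h1 : t ≠ 1 := by
      intro h1
      rw [h1] at hq
      have : ((3 : ℕ) : ZMod p) = 0 := by push_cast; linear_combination hq
      rw [ZMod.natCast_eq_zero_iff] at this
      have := (Nat.prime_dvd_prime_iff_eq hp Nat.prime_three).1 this
      omega
    have h3 : t ^ 3 = 1 := by linear_combination (t - 1) * hq
    have := Fact.mk Nat.prime_three
    have ho : orderOf t = 3 := orderOf_eq_prime h3 h1
    have ht0 : t ≠ 0 := by rintro h0; rw [h0] at h3; simp at h3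
    have := ZMod.orderOf_dvd_card_sub_one ht0
    rw [ho] at this
    have := hp.two_le
    omega
  have hx : (x : ZMod p) = 0 := by
    rw [hy] at hz; simpa using hz
  exact ⟨(ZMod.intCast_zmod_eq_zero_iff_dvd _ _).1 hx, (ZMod.intCast_zmod_eq_zero_iff_dvd _ _).1 hy⟩

lemma exists_rep (p : ℕ) (hp : p.Prime) (h1 : p % 3 = 1) :
    ∃ a b : ℤ, a ^ 2 + a * b + b ^ 2 = p := by
  have := Fact.mk hp
  have := Fact.mk Nat.prime_three
  have hd : 3 ∣ Nat.card (ZMod p)ˣ := by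
    rw [Nat.card_eq_fintype_card, ZMod.card_units]; have := hp.two_le; omega
  obtain ⟨u, hu⟩ := exists_prime_orderOf_dvd_card' 3 hd
  set t : ZMod p := (u : ZMod p) with ht
  have ht3 : t ^ 3 = 1 := by
    rw [ht, ← Units.val_pow_eq_pow_val, ← hu, pow_orderOf_eq_one]; rfl
  have ht1 : t ≠ 1 := by
    intro h
    have : u = 1 := Units.ext h
    rw [this, orderOf_one] at hu; omega
  have hq : t ^ 2 + t + 1 = 0 := by
    have : (t - 1) * (t ^ 2 + t + 1) = 0 := by linear_combination ht3
    rcases mul_eq_zero.1 this with h | h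
    · exact absurd (sub_eq_zero.1 h) ht1
    · exact h
  set k := Nat.sqrt p with hk
  have hk1 : p < (k + 1) * (k + 1) := Nat.lt_succ_sqrt p
  have hk2 : k * k ≤ p := Nat.sqrt_le p
  have hk3 : k * k ≠ p := by
    intro h
    exact (Nat.Prime.prime hp).irreducible.not_isSquare ⟨k, h.symm⟩
  obtain ⟨⟨x1, y1⟩, hm1, ⟨x2, y2⟩, hm2, hne, heq⟩ :=
    Finset.exists_ne_map_eq_of_card_lt_of_maps_to
      (s := Finset.range (k + 1) ×ˢ Finset.range (k + 1)) (t := (Finset.univ : Finset (ZMod p)))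
      (f := fun z => (z.1 : ZMod p) - t * z.2)
      (by simpa [ZMod.card] using hk1) (fun _ _ => Finset.mem_coe.2 (Finset.mem_univ _))
  simp only [Finset.mem_product, Finset.mem_range] at hm1 hm2
  simp only at heq
  obtain ⟨x, hx⟩ : ∃ x : ℤ, x = x1 - x2 := ⟨_, rfl⟩
  obtain ⟨y, hy⟩ : ∃ y : ℤ, y = y1 - y2 := ⟨_, rfl⟩
  have hxk : x ^ 2 < p := by
    have : x ^ 2 ≤ (k : ℤ) ^ 2 := by apply sq_le_sq'  <;> omega
    have h3 : ((k * k : ℕ) : ℤ) < p := by exact_mod_cast lt_of_le_of_ne hk2 hk3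
    push_cast at h3; nlinarith
  have hyk : y ^ 2 < p := by
    have : y ^ 2 ≤ (k : ℤ) ^ 2 := by apply sq_le_sq'  <;> omega
    have h3 : ((k * k : ℕ) : ℤ) < p := by exact_mod_cast lt_of_le_of_ne hk2 hk3
    push_cast at h3; nlinarith
  have hxy : (x : ZMod p) = t * y := by
    rw [hx, hy]; push_cast; linear_combination heq
  have hdvd : (p : ℤ) ∣ x ^ 2 + x * y + y ^ 2 := by
    rw [← ZMod.intCast_zmod_eq_zero_iff_dvd]
    push_cast
    rw [hxy]; linear_combination (y : ZMod p) ^ 2 * hq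
  have hne0 : x ≠ 0 ∨ y ≠ 0 := by
    by_contra! h
    apply hne
    simp only [Prod.mk.injEq]; omega
  have hpos : 0 < x ^ 2 + x * y + y ^ 2 := by
    rcases hne0 with h | h
    · have := sq_pos_of_ne_zero h
      nlinarith [sq_nonneg (x + 2 * y)]
    · have := sq_pos_of_ne_zero h
      nlinarith [sq_nonneg (2 * x + y)]
  have hlt : x ^ 2 + x * y + y ^ 2 < 3 * p := by nlinarith [sq_nonneg (x - y)]
  obtain ⟨m, hm⟩ := hdvd
  have hp0 : (0 : ℤ) < p := by exact_mod_cast hp.pos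
  have hm0 : 0 < m := by
    by_contra! h; nlinarith
  have hm3 : m < 3 := by
    by_contra! h; nlinarith
  have hm12 : m = 1 ∨ m = 2 := by omega
  rcases hm12 with rfl | rfl
  · exact ⟨x, y, by linarith⟩
  · exfalso
    have he : x % 2 = 0 ∧ y % 2 = 0 := by
      have h2 : (x ^ 2 + x * y + y ^ 2) % 2 = 0 := by omega
      rcases Int.emod_two_eq_zero_or_one x with h | h <;>
      rcases Int.emod_two_eq_zero_or_one y with h' | h' <;>
      simp [pow_two, Int.add_emod, Int.mul_emod, h, h'] at h2 ⊢
    obtain ⟨x', rfl⟩ := Int.dvd_of_emod_eq_zero he.1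
    obtain ⟨y', rfl⟩ := Int.dvd_of_emod_eq_zero he.2
    have : (p : ℤ) = 2 * (x' ^ 2 + x' * y' + y' ^ 2) := by linarith
    have h2p : 2 ∣ p := by
      have : (2 : ℤ) ∣ p := ⟨_, this⟩
      exact_mod_cast this
    have := (Nat.prime_dvd_prime_iff_eq Nat.prime_two hp).1 h2p
    omega

lemma r_one (p n : ℕ) (hp : p.Prime) (h1 : p % 3 = 1) :
    r (p * n) + (if p ∣ n then r (n / p) else 0) = 2 * r n := by
  obtain ⟨a, b, hab⟩ := exists_rep p hp h1
  have hpp : Prime (p : ℤ) := Nat.prime_iff_prime_int.1 hp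
  have hp' : (p : ℤ) ≠ 0 := hpp.ne_zero
  have hp3 : ¬ (p : ℤ) ∣ 3 := by
    intro h
    have : p ∣ 3 := by exact_mod_cast h
    have := (Nat.prime_dvd_prime_iff_eq hp Nat.prime_three).1 this
    omega
  have hb : ¬ (p : ℤ) ∣ b := by
    rintro hb
    have ha : (p : ℤ) ∣ a := by
      apply hpp.dvd_of_dvd_pow (n := 2)
      have : a ^ 2 = p - b * (a + b) := by linear_combination hab
      rw [this]
      exact dvd_sub (dvd_refl _) (hb.mul_right _)
    obtain ⟨u, rfl⟩ := ha
    obtain ⟨v, rfl⟩ := hb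
    apply hpp.not_dvd_one
    refine ⟨u ^ 2 + u * v + v ^ 2, ?_⟩
    apply mul_left_cancel₀ hp'
    linear_combination -hab
  have hab2 : ¬ (p : ℤ) ∣ 2 * a + b := by
    intro h
    have h3 : (p : ℤ) ∣ 3 * b ^ 2 := by
      have : 3 * b ^ 2 = 4 * p - (2 * a + b) * (2 * a + b) := by linear_combination 4 * hab
      rw [this]
      exact dvd_sub (Dvd.intro_left _ rfl) (h.mul_right _)
    rcases hpp.dvd_or_dvd h3 with h | h
    · exact hp3 h
    · exact hb (hpp.dvd_of_dvd_pow h)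
  have hA := count_mul a b p n hp.pos hab
  have hB := count_mul (a + b) (-b) p n hp.pos (by rw [← hab]; ring)
  have hC := count_p p n hp
  have hfin := S_finite (p * n)
  set A := {x ∈ S (p * n) | (p : ℤ) ∣ x.2 * a - x.1 * b ∧ (p : ℤ) ∣ x.1 * a + x.1 * b + x.2 * b} with hAdef
  set B := {x ∈ S (p * n) | (p : ℤ) ∣ x.2 * (a + b) - x.1 * (-b) ∧
    (p : ℤ) ∣ x.1 * (a + b) + x.1 * (-b) + x.2 * (-b)} with hBdef
  set C := {x ∈ S (p * n) | (p : ℤ) ∣ x.1 ∧ (p : ℤ) ∣ x.2} with hCdef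
  have hU : A ∪ B = S (p * n) := by
    ext ⟨x, y⟩
    simp only [hAdef, hBdef, Set.mem_union, Set.mem_ofPred_eq]
    constructor
    · rintro (h | h) <;> exact h.1
    · intro h
      have hQ : x ^ 2 + x * y + y ^ 2 = p * n := by
        simpa [S, Q] using h
      have hprod : (p : ℤ) ∣ (y * a - x * b) * (y * (a + b) - x * (-b)) :=
        ⟨y ^ 2 - b ^ 2 * n, by linear_combination y ^ 2 * hab - b ^ 2 * hQ⟩
      rcases hpp.dvd_or_dvd hprod with h' | h'
      · left
        refine ⟨h, h', ?_⟩
        have : (p : ℤ) ∣ b * (x * a + x * b + y * b) := by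
          have e : b * (x * a + x * b + y * b) = p * y - (y * a - x * b) * (a + b) := by
            linear_combination y * hab
          rw [e]
          exact dvd_sub (Dvd.intro _ rfl) (h'.mul_right _)
        exact (hpp.dvd_or_dvd this).resolve_left hb
      · right
        refine ⟨h, h', ?_⟩
        have : (p : ℤ) ∣ b * (x * (a + b) + x * (-b) + y * (-b)) := by
          have e : b * (x * (a + b) + x * (-b) + y * (-b)) =
              (y * (a + b) - x * (-b)) * a - p * y := by
            linear_combination -y * hab
          rw [e]
          exact dvd_sub (h'.mul_right _) (Dvd.intro _ rfl)
        exact (hpp.dvd_or_dvd this).resolve_left hb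
  have hI : A ∩ B = C := by
    ext ⟨x, y⟩
    simp only [hAdef, hBdef, hCdef, Set.mem_inter_iff, Set.mem_ofPred_eq]
    constructor
    · rintro ⟨⟨h, h1, -⟩, -, h2, -⟩
      have hy : (p : ℤ) ∣ y := by
        have : (p : ℤ) ∣ y * (2 * a + b) := by
          have e : y * (2 * a + b) = (y * a - x * b) + (y * (a + b) - x * (-b)) := by ring
          rw [e]; exact dvd_add h1 h2
        exact (hpp.dvd_or_dvd this).resolve_right hab2
      refine ⟨h, ?_, hy⟩
      have : (p : ℤ) ∣ x * b := by
        have e : x * b = y * a - (y * a - x * b) := by ring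
        rw [e]; exact dvd_sub (hy.mul_right a) h1
      exact (hpp.dvd_or_dvd this).resolve_right hb
    · rintro ⟨h, hx, hy⟩
      exact ⟨⟨h, dvd_sub (hy.mul_right _) (hx.mul_right _),
        dvd_add (dvd_add (hx.mul_right _) (hx.mul_right _)) (hy.mul_right _)⟩,
        h, dvd_sub (hy.mul_right _) (hx.mul_right _),
        dvd_add (dvd_add (hx.mul_right _) (hx.mul_right _)) (hy.mul_right _)⟩
  have := Set.ncard_union_add_ncard_inter A B (hfin.subset (Set.sep_subset _ _))
    (hfin.subset (Set.sep_subset _ _))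
  rw [hU, hI, hA, hB, hC] at this
  unfold r at *
  omega

lemma r_of_one : r 1 = 6 := by
  have : S 1 = (({(1, 0), (-1, 0), (0, 1), (0, -1), (1, -1), (-1, 1)} : Finset (ℤ × ℤ)) : Set (ℤ × ℤ)) := by
    ext ⟨x, y⟩
    simp only [S, Q, Set.mem_ofPred_eq]
    constructor
    · intro h
      push_cast at h
      have hx : x ^ 2 < 4 := by nlinarith [sq_nonneg (x + 2 * y)]
      have hy : y ^ 2 < 4 := by nlinarith [sq_nonneg (2 * x + y)]
      have hx1 : x < 2 := by nlinarith
      have hx2 : -2 < x := by nlinarith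
      have hy1 : y < 2 := by nlinarith
      have hy2 : -2 < y := by nlinarith
      interval_cases x <;> interval_cases y <;> simp at h ⊢
    · intro h
      simp at h
      rcases h with h | h | h | h | h | h <;> obtain ⟨rfl, rfl⟩ := h <;> norm_num
  rw [r, this, Set.ncard_coe_finset]
  rfl

lemma r_zero : r 0 = 1 := by
  have : S 0 = {(0, 0)} := by
    ext ⟨x, y⟩
    simp only [S, Q, Set.mem_ofPred_eq, Set.mem_singleton_iff, Prod.mk.injEq]
    constructor
    · intro h
      push_cast at h
      have hx : x ^ 2 = 0 := by nlinarith [sq_nonneg (x + 2 * y), sq_nonneg x]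
      have hy : y ^ 2 = 0 := by nlinarith [sq_nonneg (2 * x + y), sq_nonneg y]
      exact ⟨pow_eq_zero_iff two_ne_zero |>.1 hx, pow_eq_zero_iff two_ne_zero |>.1 hy⟩
    · rintro ⟨rfl, rfl⟩; norm_num
  rw [r, this, Set.ncard_singleton]

lemma r_eq (N : ℕ) (hN : 0 < N) : (r N : ℤ) = 6 * c N := by
  induction N using Nat.strong_induction_on with
  | _ N ih =>
    by_cases h1 : N = 1
    · subst h1; rw [r_of_one]; simp [c, chi]
    · have hp := Nat.minFac_prime h1
      obtain ⟨n, hn⟩ := Nat.minFac_dvd N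
      generalize N.minFac = p at hp hn
      subst hn
      have hn0 : 0 < n := Nat.pos_of_mul_pos_left hN
      have hlt : n < p * n := by nlinarith [hp.two_le]
      have ihn := ih n hlt hn0
      have ihd : p ∣ n → (r (n / p) : ℤ) = 6 * c (n / p) := by
        intro hd
        exact ih _ (lt_of_le_of_lt (Nat.div_le_self _ _) hlt)
          (Nat.div_pos (Nat.le_of_dvd hn0 hd) hp.pos)
      rw [c_rec p n hp hn0]
      have hmod : p % 3 = 0 ∨ p % 3 = 1 ∨ p % 3 = 2 := by omega
      rcases hmod with h | h | h
      · have : p = 3 := ((Nat.prime_dvd_prime_iff_eq Nat.prime_three hp).1 (Nat.dvd_of_mod_eq_zero h)).symm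
        subst this
        rw [r_three, ihn]; simp [chi]
      · have hr := r_one p n hp h
        have hc : chi p = 1 := by simp [chi, h]
        rw [hc]
        split_ifs at hr ⊢ with hd
        · have := ihd hd; zify at hr; linarith
        · zify at hr; linarith
      · have hr := r_two p n hp h
        have hc : chi p = -1 := by simp [chi, h]
        rw [hc, hr]
        split_ifs with hd
        · rw [ihd hd]; ring
        · simp

lemma r_le (N : ℕ) : (r N : ℝ) ≤ 6 * N + 1 := by
  rcases Nat.eq_zero_or_pos N with rfl | h
  · simp [r_zero]
  · have h1 : c N ≤ N := by
      have : c N ≤ ∑ d ∈ N.divisors, (1 : ℤ) := by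
        apply Finset.sum_le_sum
        intro d _
        unfold chi; split_ifs <;> norm_num
      refine this.trans ?_
      simpa using Nat.card_divisors_le_self N
    have h2 : (r N : ℤ) ≤ 6 * N + 1 := by rw [r_eq N h]; linarith
    exact_mod_cast h2

lemma norm_q (τ : ℂ) (hτ : 0 < τ.im) : ‖qq τ‖ < 1 := by
  unfold qq
  rw [Complex.norm_exp, Real.exp_lt_one_iff]
  simp
  positivity

/-- The form as a natural number. -/
def QN (x : ℤ × ℤ) : ℕ := (Q x).toNat

lemma QN_cast (x : ℤ × ℤ) : (QN x : ℤ) = Q x := Int.toNat_of_nonneg (Q_nonneg x)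

lemma fiber_card (N : ℕ) : Nat.card {x // QN x = N} = r N := by
  rw [r, ← Nat.card_coe_set_eq]
  have : S N = {x | QN x = N} := by
    ext x
    simp only [S, Set.mem_ofPred_eq, ← QN_cast]
    exact_mod_cast Iff.rfl
  rw [this]; rfl

lemma fiber_finite (N : ℕ) : Finite {x // QN x = N} := by
  have : ({x | QN x = N} : Set (ℤ × ℤ)).Finite := (S_finite N).subset (fun x hx => by
    simp only [S, Set.mem_ofPred_eq] at hx ⊢
    rw [← QN_cast, hx])
  exact this.to_subtype

lemma tsum_fiber (z : ℂ) (hz : ‖z‖ < 1) :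
    ∑' x : ℤ × ℤ, z ^ QN x = ∑' N : ℕ, (r N : ℂ) * z ^ N ∧
    Summable (fun N : ℕ => (r N : ℂ) * z ^ N) := by
  have hf := fiber_finite
  have hs0 : Summable (fun N : ℕ => (r N : ℝ) * ‖z‖ ^ N) := by
    have hb : Summable (fun N : ℕ => 6 * ((N : ℝ) ^ 1 * ‖z‖ ^ N) + ‖z‖ ^ N) :=
      ((summable_pow_mul_geometric_of_norm_lt_one (R := ℝ) (r := ‖z‖) 1
        (by rw [norm_norm]; exact hz)).mul_left 6).add
        (summable_geometric_of_lt_one (norm_nonneg _) hz)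
    refine Summable.of_nonneg_of_le (fun N => by positivity) (fun N => ?_) hb
    have := mul_le_mul_of_nonneg_right (r_le N) (pow_nonneg (norm_nonneg z) N)
    linarith
  let e := Equiv.sigmaFiberEquiv QN
  have hval : ∀ (N : ℕ) (x : {x // QN x = N}), QN (e ⟨N, x⟩) = N := fun N x => x.2
  have hsn : Summable (fun s : (Σ N, {x // QN x = N}) => ‖z ^ QN (e s)‖) := by
    rw [summable_sigma_of_nonneg (fun _ => norm_nonneg _)]
    refine ⟨fun N => Summable.of_finite, ?_⟩
    refine hs0.congr fun N => ?_
    simp only [hval, tsum_const, fiber_card, norm_pow, nsmul_eq_mul]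
  refine ⟨?_, ?_⟩
  · rw [← e.tsum_eq, hsn.of_norm.tsum_sigma' (fun N => Summable.of_finite)]
    refine tsum_congr fun N => ?_
    simp only [hval, tsum_const, fiber_card, nsmul_eq_mul]
  · refine Summable.of_norm (hs0.congr fun N => ?_)
    simp

end BCT

theorem borwein_cubic_theta_eq_eisenstein (τ : ℂ) (hτ : 0 < τ.im) :
    A3 τ = 1 + 6 * ∑' n : ℕ, (∑ d ∈ (n + 1).divisors, chiNeg3 d) * qq τ ^ (n + 1) := by
  obtain ⟨h1, h2⟩ := BCT.tsum_fiber (qq τ) (BCT.norm_q τ hτ)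
  have h3 : A3 τ = ∑' x : ℤ × ℤ, qq τ ^ BCT.QN x := by
    unfold A3
    refine tsum_congr fun x => ?_
    rw [← zpow_natCast, BCT.QN_cast]; rfl
  rw [h3, h1, h2.tsum_eq_zero_add, ← tsum_mul_left]
  congr 1
  · simp [BCT.r_zero]
  · refine tsum_congr fun n => ?_
    have h := congrArg (Int.cast : ℤ → ℂ) (BCT.r_eq (n + 1) n.succ_pos)
    push_cast at h
    rw [h, mul_assoc]
    congr 2
    rw [BCT.c]
    push_cast
    refine Finset.sum_congr rfl fun d _ => ?_
    unfold BCT.chi chiNeg3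
    split_ifs <;> simp
end
end

section
/- New generalized Chazy equations attached to the Fricke groups Γ₀⁺(2) and Γ₀⁺(3): (i) the function u(τ) = (πi/4)·ℰ₈(τ), where ℰ₈(τ) = (1/3)[2E₂(q²) + E₂(q)], satisfies 2u₄u₈ − u₆² + 32u₄³ = 0 on the upper half-plane; (ii) the function u(τ) = (πi/3)·ℰ₆(τ), where ℰ₆(τ) = (1/4)[3E₂(q³) + E₂(q)], satisfies 4u₄u₈ − 3u₆² + 48u₄³ = 0 on the upper half-plane. -/
open Complex

noncomputable section

/-- The quasi-modular Eisenstein series E₂ as a function of its argument q: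
E₂(x) = 1 − 24 ∑_{n≥1} σ₁(n) xⁿ. -/
def EisE2 (x : ℂ) : ℂ := 1 - 24 * ∑' n : ℕ, (∑ d ∈ (n + 1).divisors, (d : ℂ)) * x ^ (n + 1)

/-- ℰ₈(τ) = (1/3)[2E₂(q²) + E₂(q)]. -/
def E8sig (τ : ℂ) : ℂ := (1 / 3) * (2 * EisE2 (qq τ ^ 2) + EisE2 (qq τ))

/-- ℰ₆(τ) = (1/4)[3E₂(q³) + E₂(q)]. -/
def E6sig (τ : ℂ) : ℂ := (1 / 4) * (3 * EisE2 (qq τ ^ 3) + EisE2 (qq τ))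

/-- u₄ = u̇ − u². -/
def chazyU4 (u : ℂ → ℂ) (τ : ℂ) : ℂ := deriv u τ - u τ ^ 2

/-- u₆ = ü − 6uu̇ + 4u³. -/
def chazyU6 (u : ℂ → ℂ) (τ : ℂ) : ℂ :=
  deriv (deriv u) τ - 6 * u τ * deriv u τ + 4 * u τ ^ 3

/-- u₈ = u⃛ − 12uü − 6u̇² + 48u²u̇ − 24u⁴. -/
def chazyU8 (u : ℂ → ℂ) (τ : ℂ) : ℂ :=
  deriv (deriv (deriv u)) τ - 12 * u τ * deriv (deriv u) τ - 6 * (deriv u τ) ^ 2 +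
    48 * u τ ^ 2 * deriv u τ - 24 * u τ ^ 4


theorem denom_T_eq_one (z : UpperHalfPlane) :
    UpperHalfPlane.denom (Matrix.SpecialLinearGroup.toGL
      ((Matrix.SpecialLinearGroup.map (Int.castRingHom ℝ)) ModularGroup.T)) (z : ℂ) = 1 := by
  have h := ModularGroup.denom_apply ModularGroup.T z
  refine h.trans ?_
  simp [ModularGroup.T]

open UpperHalfPlane ModularForm Filter Topology Asymptotics in
/-- A holomorphic function on the upper half plane, modular of level one and weight `k < 12` that
vanishes at `i∞`, is zero. -/
theorem cusp_small (k : ℕ) (hk : k < 12) (f : ℂ → ℂ)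
    (hd : DifferentiableOn ℂ f {z | 0 < z.im})
    (hT : ∀ z : ℂ, 0 < z.im → f (z + 1) = f z)
    (hS : ∀ z : ℂ, 0 < z.im → f (-1 / z) = z ^ k * f z)
    (h0 : Tendsto (fun z : ℍ => f z) atImInfty (𝓝 0)) (z : ℂ) (hz : 0 < z.im) : f z = 0 := by
  have key := fun γ => SlashInvariantForm.slash_action_generators_SL2Z
    (f := fun z : ℍ => f z) (k := k) (by
      ext z
      rw [SlashInvariantForm.slash_S_apply]
      have hz : (z : ℂ) ≠ 0 := z.ne_zero
      have := hS z z.im_pos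
      have e : ((UpperHalfPlane.mk (-(z:ℂ))⁻¹ z.im_inv_neg_coe_pos : ℍ) : ℂ) = -1 / z := by
        simp [neg_div, inv_neg]
      rw [e, this]
      simp [zpow_neg]
      field_simp) (by
      ext z
      rw [SL_slash_apply, modular_T_smul]
      have := hT z z.im_pos
      have e : (((1:ℝ) +ᵥ z : ℍ) : ℂ) = z + 1 := by
        simp [add_comm]
      rw [e, this]
      simp [denom_T_eq_one]) γ
  let F : CuspForm (Matrix.SpecialLinearGroup.mapGL ℝ : Matrix.SpecialLinearGroup (Fin 2) ℤ →* _).range (k : ℤ) :=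
    { toFun := fun z : ℍ => f z
      slash_action_eq' := by
        rintro A ⟨A, rfl⟩
        exact key A
      holo' := by
        rw [UpperHalfPlane.mdifferentiable_iff]
        refine hd.congr fun z hz => ?_
        simp [ofComplex_apply_of_im_pos hz]
      zero_at_cusps' := by
        intro c hc
        rw [Subgroup.IsArithmetic.isCusp_iff_isCusp_SL2Z] at hc
        rw [OnePoint.isZeroAt_iff_forall_SL2Z hc]
        intro γ _
        rw [key γ]
        exact h0 }
  have hF : F = 0 := rank_zero_iff_forall_zero.mp
    (CuspForm.rank_eq_zero_of_weight_lt_twelve (by exact_mod_cast hk)) F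
  have := DFunLike.congr_fun hF (⟨z, hz⟩ : ℍ)
  exact this

open UpperHalfPlane ModularForm Filter Topology Asymptotics in
/-- A holomorphic function on the upper half plane, modular of level one and weight
`k + 12 < 24` that is `O(q²)` at `i∞`, is zero. -/
theorem cusp_small2 (k : ℕ) (hk : k < 12) (f : ℂ → ℂ)
    (hd : DifferentiableOn ℂ f {z | 0 < z.im})
    (hT : ∀ z : ℂ, 0 < z.im → f (z + 1) = f z)
    (hS : ∀ z : ℂ, 0 < z.im → f (-1 / z) = z ^ (k + 12) * f z)
    (h0 : (fun z : ℍ => f z) =O[atImInfty]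
      (fun z : ℍ => Real.exp (-2 * Real.pi * z.im) * Real.exp (-2 * Real.pi * z.im)))
    (z : ℂ) (hz : 0 < z.im) : f z = 0 := by
  let d : ℂ → ℂ := fun z => discriminant (ofComplex z)
  have d0 : ∀ z, d z ≠ 0 := fun z => discriminant_ne_zero _
  have dd : DifferentiableOn ℂ d {z | 0 < z.im} := by
    have := CuspForm.discriminant.holo'
    rw [UpperHalfPlane.mdifferentiable_iff] at this
    exact this
  have dc : ∀ z : ℍ, d z = discriminant z := fun z => by simp [d, ofComplex_apply]
  have dT : ∀ z : ℍ, d (z + 1) = d z := fun z => by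
    have h := congrFun discriminant_T_invariant z
    rw [SL_slash_apply, modular_T_smul] at h
    have e : (((1:ℝ) +ᵥ z : ℍ) : ℂ) = z + 1 := by simp [add_comm]
    rw [← e, dc, dc, ← h]
    simp [denom_T_eq_one]
  have dS : ∀ z : ℍ, d (-1 / z) = z ^ 12 * d z := fun z => by
    have h := congrFun discriminant_S_invariant z
    rw [SlashInvariantForm.slash_S_apply] at h
    have hz : (z : ℂ) ≠ 0 := z.ne_zero
    have e : ((UpperHalfPlane.mk (-(z:ℂ))⁻¹ z.im_inv_neg_coe_pos : ℍ) : ℂ) = -1 / z := by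
      simp [neg_div, inv_neg]
    rw [← e, dc, dc, ← h]
    simp [zpow_neg]
    field_simp
  have := cusp_small k hk (fun z => f z / d z) (hd.div dd fun z _ => d0 z)
    (fun z hz => by
      have := dT ⟨z, hz⟩
      simp only at this
      rw [hT z hz, this])
    (fun z hz => by
      have := dS ⟨z, hz⟩
      simp only at this
      rw [hS z hz, this]
      have h1 := d0 z
      have h2 : z ≠ 0 := by rintro rfl; simp at hz
      field_simp
      ring) ?_ z hz
  · have h1 := d0 z
    field_simp at this
    simpa using this
  · have h1 : (fun z : ℍ => f z / d z) =O[atImInfty]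
        (fun z : ℍ => Real.exp (-2 * Real.pi * z.im)) := by
      have h2 : (fun z : ℍ => f z) =O[atImInfty]
          (fun z : ℍ => (Real.exp (-2 * Real.pi * z.im) : ℂ) * d z) := by
        refine h0.trans ?_
        refine IsBigO.mul ?_ ?_
        · refine IsBigO.of_bound 1 (Eventually.of_forall fun z => ?_)
          simp [-Complex.ofReal_exp]
        · simp_rw [dc]
          exact exp_isBigO_discriminant
      have h3 := h2.mul (isBigO_refl (fun z : ℍ => (d z)⁻¹) atImInfty)
      have h4 : (fun z : ℍ => (Real.exp (-2 * Real.pi * z.im) : ℂ) * d z * (d z)⁻¹) =O[atImInfty]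
        (fun z : ℍ => Real.exp (-2 * Real.pi * z.im)) := by
        refine IsBigO.of_bound 1 (Eventually.of_forall fun z => ?_)
        rw [mul_inv_cancel_right₀ (d0 z)]
        simp [-Complex.ofReal_exp]
      exact h3.trans h4
    refine h1.trans_tendsto ?_
    refine Real.tendsto_exp_atBot.comp ?_
    have : Tendsto (fun z : ℍ => z.im) atImInfty atTop := tendsto_comap
    exact this.const_mul_atTop_of_neg (by linarith [Real.pi_pos])

/-- `EisE2` is holomorphic on the unit disc. -/
theorem eisE2_diff : DifferentiableOn ℂ EisE2 (Metric.ball 0 1) := by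
  have hb : ∀ n : ℕ, ‖∑ d ∈ (n + 1).divisors, (d : ℂ)‖ ≤ ((n + 1 : ℕ) : ℝ) ^ 2 := by
    intro n
    refine (norm_sum_le _ _).trans ?_
    calc ∑ d ∈ (n + 1).divisors, ‖(d : ℂ)‖ ≤ ∑ d ∈ (n + 1).divisors, ((n + 1 : ℕ) : ℝ) := by
          refine Finset.sum_le_sum fun d hd => ?_
          rw [Complex.norm_natCast]
          exact_mod_cast Nat.divisor_le hd
      _ = (n + 1).divisors.card * ((n + 1 : ℕ) : ℝ) := by
          rw [Finset.sum_const, nsmul_eq_mul]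
      _ ≤ ((n + 1 : ℕ) : ℝ) * ((n + 1 : ℕ) : ℝ) := by
          gcongr
          exact Nat.card_divisors_le_self _
      _ = _ := by ring
  intro x hx
  obtain ⟨r, hxr, hr⟩ := exists_between (mem_ball_zero_iff.mp hx)
  have hr0 : 0 ≤ r := (norm_nonneg _).trans hxr.le
  have hs : DifferentiableOn ℂ (fun x : ℂ => ∑' n : ℕ, (∑ d ∈ (n + 1).divisors, (d : ℂ)) * x ^ (n + 1))
      (Metric.ball 0 r) := by
    refine Complex.differentiableOn_tsum_of_summable_norm
      (u := fun n : ℕ => ((n + 1 : ℕ) : ℝ) ^ 2 * r ^ (n + 1)) ?_ ?_ Metric.isOpen_ball ?_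
    · have := summable_pow_mul_geometric_of_norm_lt_one 2 (r := r)
        (by rwa [Real.norm_of_nonneg hr0])
      exact (summable_nat_add_iff 1).mpr this
    · intro n
      fun_prop
    · intro n w hw
      rw [norm_mul, norm_pow]
      have : ‖w‖ ≤ r := (mem_ball_zero_iff.mp hw).le
      gcongr
      exact hb n
  have h2 : DifferentiableAt ℂ EisE2 x := by
    have := hs.differentiableAt (Metric.isOpen_ball.mem_nhds (mem_ball_zero_iff.mpr hxr))
    unfold EisE2
    exact (differentiableAt_const _).sub ((differentiableAt_const _).mul this)
  exact h2.differentiableWithinAt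

theorem eisE2_zero : EisE2 0 = 1 := by
  simp [EisE2]

open UpperHalfPlane in
theorem eisE2_eq (z : ℍ) : EisE2 (qq z) = EisensteinSeries.E2 z := by
  rw [EisensteinSeries.E2_eq_tsum_cexp, tsum_pnat_eq_tsum_succ
    (f := fun n ↦ (ArithmeticFunction.sigma 1 n : ℂ) * Complex.exp (2 * Real.pi * Complex.I * z) ^ n)]
  simp [EisE2, qq, ArithmeticFunction.sigma_one_apply]

theorem qq_norm_lt {z : ℂ} (hz : 0 < z.im) : ‖qq z‖ < 1 := by
  exact UpperHalfPlane.norm_exp_two_pi_I_lt_one ⟨z, hz⟩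

theorem qq_norm (z : ℂ) : ‖qq z‖ = Real.exp (-2 * Real.pi * z.im) := by
  simp [qq, Complex.norm_exp]

theorem qq_mem {z : ℂ} (hz : 0 < z.im) : qq z ∈ Metric.ball (0:ℂ) 1 :=
  mem_ball_zero_iff.mpr (qq_norm_lt hz)

theorem qq_add_one (z : ℂ) : qq (z + 1) = qq z := by
  simp [qq, mul_add, Complex.exp_add]

theorem qq_mul (n : ℕ) (z : ℂ) : qq (n * z) = qq z ^ n := by
  rw [qq, qq, ← Complex.exp_nat_mul]
  ring_nf

theorem im_S {z : ℂ} (hz : 0 < z.im) : 0 < (-1 / z).im := by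
  have h := UpperHalfPlane.im_inv_neg_coe_pos ⟨z, hz⟩
  have e : (-1 / z) = (-z)⁻¹ := by simp [neg_div, inv_neg]
  rw [e]
  exact h

theorem eisE2_S (z : ℂ) (hz : 0 < z.im) :
    EisE2 (qq (-1 / z)) = z ^ 2 * EisE2 (qq z) + 12 / (2 * Real.pi * Complex.I) * z := by
  have h := congrFun (EisensteinSeries.E2_slash_action ModularGroup.S) ⟨z, hz⟩
  rw [SlashInvariantForm.slash_S_apply] at h
  have hz0 : z ≠ 0 := by rintro rfl; simp at hz
  simp only [← eisE2_eq, Pi.sub_apply, Pi.smul_apply, EisensteinSeries.D2_S, riemannZeta_two] at h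
  have e : (-1 / z) = (-z)⁻¹ := by simp [neg_div, inv_neg]
  rw [e]
  have hpi : (Real.pi : ℂ) ≠ 0 := by exact_mod_cast Real.pi_ne_zero
  simp [zpow_neg] at h
  have h3 : EisE2 (qq (-z⁻¹)) = z ^ 2 * (EisE2 (qq (-z⁻¹)) * (z ^ 2)⁻¹) := by field_simp
  rw [inv_neg, h3, h]
  field_simp
  ring_nf
  simp only [Complex.I_sq]
  ring

/-- The constant `2πi`. -/
def cc : ℂ := 2 * Real.pi * Complex.I

theorem cc_ne : cc ≠ 0 := by
  have hpi : (Real.pi : ℂ) ≠ 0 := by exact_mod_cast Real.pi_ne_zero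
  simp [cc, hpi]

/-- `E₄` through Ramanujan's first differential equation. -/
def qQ (x : ℂ) : ℂ := EisE2 x ^ 2 - 12 * (x * deriv EisE2 x)
/-- `E₆` through Ramanujan's second differential equation. -/
def qR (x : ℂ) : ℂ := EisE2 x * qQ x - 3 * (x * deriv qQ x)
/-- The defect in Ramanujan's third differential equation. -/
def qW (x : ℂ) : ℂ := x * deriv qR x - (EisE2 x * qR x - qQ x ^ 2) / 2

theorem theta_diff {f : ℂ → ℂ} (hf : DifferentiableOn ℂ f (Metric.ball 0 1)) :
    DifferentiableOn ℂ (fun x => x * deriv f x) (Metric.ball 0 1) :=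
  differentiableOn_id.mul (hf.deriv Metric.isOpen_ball)

theorem qQ_diff : DifferentiableOn ℂ qQ (Metric.ball 0 1) :=
  (eisE2_diff.pow 2).sub ((theta_diff eisE2_diff).const_mul 12)

theorem qR_diff : DifferentiableOn ℂ qR (Metric.ball 0 1) :=
  (eisE2_diff.mul qQ_diff).sub ((theta_diff qQ_diff).const_mul 3)

theorem qW_diff : DifferentiableOn ℂ qW (Metric.ball 0 1) :=
  (theta_diff qR_diff).sub (((eisE2_diff.mul qR_diff).sub (qQ_diff.pow 2)).div_const 2)

theorem qQ_zero : qQ 0 = 1 := by simp [qQ, eisE2_zero]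
theorem qR_zero : qR 0 = 1 := by simp [qR, eisE2_zero, qQ_zero]
theorem qW_zero : qW 0 = 0 := by simp [qW, eisE2_zero, qQ_zero, qR_zero]

theorem qq_hasDeriv (t : ℂ) : HasDerivAt qq (cc * qq t) t := by
  have h : HasDerivAt (fun t : ℂ => 2 * Real.pi * Complex.I * t) (2 * Real.pi * Complex.I) t := by
    simpa using (hasDerivAt_id t).const_mul (2 * Real.pi * Complex.I : ℂ)
  have := h.cexp
  convert! this using 1
  rw [mul_comm]
  rfl

theorem comp_hasDeriv {f : ℂ → ℂ} (hf : DifferentiableOn ℂ f (Metric.ball 0 1)) {t : ℂ}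
    (ht : 0 < t.im) : HasDerivAt (fun t => f (qq t)) (cc * (qq t * deriv f (qq t))) t := by
  have h := (hf.differentiableAt (Metric.isOpen_ball.mem_nhds (qq_mem ht))).hasDerivAt
  have := h.comp t (qq_hasDeriv t)
  convert! this using 1
  ring

theorem comp_diff {f : ℂ → ℂ} (hf : DifferentiableOn ℂ f (Metric.ball 0 1)) :
    DifferentiableOn ℂ (fun t => f (qq t)) {z | 0 < z.im} :=
  fun _ ht => (comp_hasDeriv hf ht).differentiableAt.differentiableWithinAt

theorem P_hasDeriv {t : ℂ} (ht : 0 < t.im) : HasDerivAt (fun t => EisE2 (qq t))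
    (cc * ((EisE2 (qq t) ^ 2 - qQ (qq t)) / 12)) t := by
  convert comp_hasDeriv eisE2_diff ht using 1
  simp only [qQ]; ring

theorem Q_hasDeriv {t : ℂ} (ht : 0 < t.im) : HasDerivAt (fun t => qQ (qq t))
    (cc * ((EisE2 (qq t) * qQ (qq t) - qR (qq t)) / 3)) t := by
  convert comp_hasDeriv qQ_diff ht using 1
  simp only [qR]; ring

theorem R_hasDeriv0 {t : ℂ} (ht : 0 < t.im) : HasDerivAt (fun t => qR (qq t))
    (cc * (qW (qq t) + (EisE2 (qq t) * qR (qq t) - qQ (qq t) ^ 2) / 2)) t := by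
  convert comp_hasDeriv qR_diff ht using 1
  simp only [qW]; ring

/-- Differentiating a transformation law under `z ↦ -1/z`. -/
theorem deriv_S (k : ℕ) (s : ℂ) (f f' : ℂ → ℂ)
    (hf : ∀ z : ℂ, 0 < z.im → HasDerivAt f (f' z) z)
    (hS : ∀ z : ℂ, 0 < z.im → f (-1 / z) = z ^ (k + 1) * f z + s * z) (z : ℂ) (hz : 0 < z.im) :
    f' (-1 / z) = z ^ 2 * ((k + 1) * z ^ k * f z + z ^ (k + 1) * f' z + s) := by
  have hz0 : z ≠ 0 := by rintro rfl; simp at hz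
  have hi : HasDerivAt (fun z : ℂ => -1 / z) (1 / z ^ 2) z := by
    have := (hasDerivAt_inv hz0).const_mul (-1)
    convert! this using 1
    simp
  have h1 := (hf _ (im_S hz)).comp z hi
  have h2 : HasDerivAt (fun z => z ^ (k + 1) * f z + s * z)
      ((k + 1) * z ^ k * f z + z ^ (k + 1) * f' z + s) z := by
    have := ((hasDerivAt_pow (k + 1) z).mul (hf z hz)).add ((hasDerivAt_id z).const_mul s)
    convert! this using 1
    simp
  have h3 : (f ∘ fun z : ℂ => -1 / z) =ᶠ[nhds z] (fun z => z ^ (k + 1) * f z + s * z) := by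
    filter_upwards [(isOpen_lt continuous_const Complex.continuous_im).mem_nhds hz] with w hw
    exact hS w hw
  have := h1.unique (h2.congr_of_eventuallyEq h3)
  rw [← this]
  field_simp

theorem Q_S (z : ℂ) (hz : 0 < z.im) : qQ (qq (-1 / z)) = z ^ 4 * qQ (qq z) := by
  have h := deriv_S 1 _ _ _ (fun z hz => P_hasDeriv hz) eisE2_S z hz
  have hS := eisE2_S z hz
  have hc := cc_ne
  rw [show (2 * Real.pi * Complex.I : ℂ) = cc from rfl] at h hS
  simp only [hS] at h
  field_simp at h
  linear_combination (norm := skip) (-1 / cc ^ 2) * h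
  push_cast
  field_simp
  ring

theorem R_S (z : ℂ) (hz : 0 < z.im) : qR (qq (-1 / z)) = z ^ 6 * qR (qq z) := by
  have h := deriv_S 3 0 _ _ (fun z hz => Q_hasDeriv hz)
    (fun z hz => by rw [Q_S z hz]; ring) z hz
  have hS := eisE2_S z hz
  have hc := cc_ne
  rw [show (2 * Real.pi * Complex.I : ℂ) = cc from rfl] at hS
  simp only [hS, Q_S z hz] at h
  field_simp at h
  linear_combination (norm := skip) (-1 / cc) * h
  push_cast
  field_simp
  ring

theorem W_S (z : ℂ) (hz : 0 < z.im) : qW (qq (-1 / z)) = z ^ 8 * qW (qq z) := by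
  have h := deriv_S 5 0 _ _ (fun z hz => R_hasDeriv0 hz)
    (fun z hz => by rw [R_S z hz]; ring) z hz
  have hS := eisE2_S z hz
  have hc := cc_ne
  rw [show (2 * Real.pi * Complex.I : ℂ) = cc from rfl] at hS
  simp only [hS, Q_S z hz, R_S z hz] at h
  field_simp at h
  linear_combination (norm := skip) (1 / (2 * cc)) * h
  push_cast
  field_simp
  ring

open UpperHalfPlane Filter Topology Asymptotics in
/-- A holomorphic function of `q` vanishing at `q = 0` is `O(q)`. -/
theorem bigO_q {f : ℂ → ℂ} (hf : DifferentiableOn ℂ f (Metric.ball 0 1)) (h0 : f 0 = 0) :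
    f =O[𝓝 0] (fun x => x) := by
  have h := (hf.differentiableAt (Metric.isOpen_ball.mem_nhds
    (Metric.mem_ball_self one_pos))).isBigO_sub
  simpa [h0] using h

open UpperHalfPlane Filter Topology Asymptotics in
theorem qq_tendsto (a : ℝ) (ha : 0 < a) (b : ℝ) :
    Tendsto (fun z : ℍ => qq (a * z + b)) atImInfty (𝓝 0) := by
  rw [tendsto_zero_iff_norm_tendsto_zero]
  simp only [qq_norm]
  refine Real.tendsto_exp_atBot.comp ?_
  have : Tendsto (fun z : ℍ => z.im) atImInfty atTop := tendsto_comap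
  have := (this.const_mul_atTop ha).const_mul_atTop_of_neg (r := -2 * Real.pi)
    (by linarith [Real.pi_pos])
  simpa using this

open UpperHalfPlane Filter Topology Asymptotics in
theorem bigO_comp {f : ℂ → ℂ} (hf : DifferentiableOn ℂ f (Metric.ball 0 1)) (h0 : f 0 = 0)
    (a : ℝ) (ha : 0 < a) (b : ℝ) :
    (fun z : ℍ => f (qq (a * z + b))) =O[atImInfty]
      (fun z : ℍ => Real.exp (-2 * Real.pi * (a * z.im))) := by
  have h := (bigO_q hf h0).comp_tendsto (qq_tendsto a ha b)
  refine h.trans (IsBigO.of_bound 1 (Eventually.of_forall fun z => ?_))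
  simp [qq_norm]

open UpperHalfPlane Filter Topology Asymptotics in
theorem W_zero (z : ℂ) (hz : 0 < z.im) : qW (qq z) = 0 := by
  refine cusp_small 8 (by norm_num) (fun z => qW (qq z)) (comp_diff qW_diff)
    (fun z _ => by simp only [qq_add_one]) W_S ?_ z hz
  have h := ((bigO_q qW_diff qW_zero).comp_tendsto (qq_tendsto 1 one_pos 0)).trans_tendsto
    (qq_tendsto 1 one_pos 0)
  simpa [Function.comp_def] using h

theorem R_hasDeriv {t : ℂ} (ht : 0 < t.im) : HasDerivAt (fun t => qR (qq t))
    (cc * ((EisE2 (qq t) * qR (qq t) - qQ (qq t) ^ 2) / 2)) t := by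
  convert R_hasDeriv0 ht using 1
  rw [W_zero t ht, zero_add]

theorem uhp_preconn : IsPreconnected {z : ℂ | 0 < z.im} :=
  (convex_halfSpace_im_gt 0).isPreconnected

theorem uhp_open : IsOpen {z : ℂ | 0 < z.im} := isOpen_lt continuous_const Complex.continuous_im

theorem mul_zero_cases {f g : ℂ → ℂ} (hf : DifferentiableOn ℂ f {z | 0 < z.im})
    (hg : DifferentiableOn ℂ g {z | 0 < z.im}) (h : ∀ z : ℂ, 0 < z.im → f z * g z = 0) :
    (∀ z : ℂ, 0 < z.im → f z = 0) ∨ (∀ z : ℂ, 0 < z.im → g z = 0) :=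
  AnalyticOnNhd.eq_zero_or_eq_zero_of_mul_eq_zero (hf.analyticOnNhd uhp_open)
    (hg.analyticOnNhd uhp_open) h uhp_preconn

theorem im_div_nat {z : ℂ} (n : ℕ) (b : ℕ) (hn : 0 < n) (hz : 0 < z.im) :
    0 < ((z + b) / n).im := by
  rw [Complex.div_natCast_im]
  have : (0:ℝ) < n := by exact_mod_cast hn
  simp only [Complex.add_im, Complex.natCast_im, add_zero]
  positivity

theorem comp_div_diff {f : ℂ → ℂ} (hf : DifferentiableOn ℂ f {z | 0 < z.im}) (n b : ℕ)
    (hn : 0 < n) : DifferentiableOn ℂ (fun z => f ((z + b) / n)) {z | 0 < z.im} := by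
  refine hf.comp (f := fun z : ℂ => (z + b) / n) ?_ ?_
  · fun_prop
  · intro z hz
    exact im_div_nat n b hn hz

theorem zero_of_comp_div {f : ℂ → ℂ} (n b : ℕ) (hn : 0 < n)
    (h : ∀ z : ℂ, 0 < z.im → f ((z + b) / n) = 0) (z : ℂ) (hz : 0 < z.im) : f z = 0 := by
  have hn' : (n : ℂ) ≠ 0 := by exact_mod_cast hn.ne'
  have h1 : 0 < (n * z - b : ℂ).im := by
    have : (0:ℝ) < n := by exact_mod_cast hn
    simp only [Complex.sub_im, Complex.natCast_im, Complex.mul_im, Complex.natCast_re]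
    simp; positivity
  have := h _ h1
  rwa [sub_add_cancel, mul_div_cancel_left₀ _ hn'] at this

open UpperHalfPlane Filter Topology Asymptotics in
theorem bigO_div {F : ℂ → ℂ} (hF : DifferentiableOn ℂ F (Metric.ball 0 1)) (h0 : F 0 = 0)
    (n b : ℕ) (hn : 0 < n) :
    (fun z : ℍ => F (qq ((z + b) / n))) =O[atImInfty]
      (fun z : ℍ => Real.exp (-2 * Real.pi * (z.im / n))) := by
  have hn' : (0:ℝ) < n := by exact_mod_cast hn
  have h := bigO_comp hF h0 (1 / n) (by positivity) (b / n)
  convert! h using 4 with z z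
  · push_cast
    ring
  · ring

open UpperHalfPlane Filter Topology Asymptotics in
/-- Vanishing of weight four forms on `Γ₀⁺(2)` that vanish at the cusp. -/
theorem level_two {F : ℂ → ℂ} (hF : DifferentiableOn ℂ F (Metric.ball 0 1)) (h0 : F 0 = 0)
    (hW : ∀ z : ℂ, 0 < z.im → F (qq (-1 / (2 * z))) = 4 * z ^ 4 * F (qq z))
    (z : ℂ) (hz : 0 < z.im) : F (qq z) = 0 := by
  obtain ⟨f, hf⟩ : ∃ f : ℂ → ℂ, f = fun z => F (qq z) := ⟨_, rfl⟩
  have hfz : ∀ z, F (qq z) = f z := fun z => by rw [hf]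
  simp only [hfz] at hW ⊢
  have fd : DifferentiableOn ℂ f {z | 0 < z.im} := hf ▸ comp_diff hF
  have fT : ∀ z, f (z + 1) = f z := fun z => by rw [hf]; simp only [qq_add_one]
  have fT' : ∀ z, f (z - 1) = f z := fun z => by rw [← fT (z - 1), sub_add_cancel]
  have fS : ∀ z : ℂ, 0 < z.im → f (-1 / z) = z ^ 4 / 4 * f (z / 2) := fun z hz => by
    have := hW (z / 2) (by simpa using im_div_nat 2 0 (by norm_num) hz)
    rw [mul_div_cancel₀ z two_ne_zero] at this
    rw [this]; ring
  have d0 := comp_div_diff fd 2 0 (by norm_num)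
  have d1 := comp_div_diff fd 2 1 (by norm_num)
  have key := cusp_small2 0 (by norm_num)
    (fun z => f z * (f ((z + (0:ℕ)) / (2:ℕ)) * f ((z + (1:ℕ)) / (2:ℕ))))
    (fd.mul (d0.mul d1)) ?_ ?_ ?_
  · rcases mul_zero_cases fd (d0.mul d1) key with h | h
    · exact h z hz
    rcases mul_zero_cases d0 d1 h with h | h
    · exact zero_of_comp_div 2 0 (by norm_num) h z hz
    · exact zero_of_comp_div 2 1 (by norm_num) h z hz
  · intro z hz
    have e : f ((z + 1 + (1:ℕ)) / (2:ℕ)) = f (z / 2) := by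
      rw [← fT (z / 2)]; congr 1; push_cast; ring
    simp only [e, fT]
    push_cast
    simp only [add_zero]
    ring
  · intro z hz
    have hz0 : z ≠ 0 := by rintro rfl; simp at hz
    have e0 : f ((-1 / z + (0:ℕ)) / (2:ℕ)) = 4 * z ^ 4 * f z := by
      rw [← hW z hz]; congr 1; push_cast; field_simp; ring
    have e1 : f ((-1 / z + (1:ℕ)) / (2:ℕ)) = z ^ 4 * f ((z + 1) / 2) := by
      have hz1 : 0 < (z - 1).im := by simpa using hz
      have hz10 : z - 1 ≠ 0 := by intro h; rw [h] at hz1; simp at hz1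
      have a1 := fS (z - 1) hz1
      have hy : 0 < (-1 / (z - 1) - 1 : ℂ).im := by simpa using im_S hz1
      have a2 := hW _ hy
      rw [fT', a1] at a2
      have b1 : (-1 / (2 * (-1 / (z - 1) - 1)) : ℂ) = (-1 / z + (1:ℕ)) / (2:ℕ) := by
        have : (-1 / (z - 1) - 1 : ℂ) = -z / (z - 1) := by field_simp; ring
        rw [this]; push_cast; field_simp; ring
      have b2 : f ((z - 1) / 2) = f ((z + 1) / 2) := by
        rw [← fT ((z - 1) / 2)]; congr 1; ring
      rw [b1, b2] at a2
      rw [a2]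
      have : (-1 / (z - 1) - 1 : ℂ) = -z / (z - 1) := by field_simp; ring
      rw [this]; field_simp
    simp only [e0, e1, fS z hz]
    push_cast
    simp only [add_zero]
    ring
  · have o0 := bigO_div hF h0 1 0 (by norm_num)
    have o1 := bigO_div hF h0 2 0 (by norm_num)
    have o2 := bigO_div hF h0 2 1 (by norm_num)
    simp only [hfz] at o0 o1 o2
    convert! o0.mul (o1.mul o2) using 2 with z z
    · simp
    · simp only [← Real.exp_add]
      congr 1
      push_cast
      ring

open UpperHalfPlane Filter Topology Asymptotics in
/-- Vanishing of weight four forms on `Γ₀⁺(3)` that vanish at the cusp. -/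
theorem level_three {F : ℂ → ℂ} (hF : DifferentiableOn ℂ F (Metric.ball 0 1)) (h0 : F 0 = 0)
    (hW : ∀ z : ℂ, 0 < z.im → F (qq (-1 / (3 * z))) = 9 * z ^ 4 * F (qq z))
    (z : ℂ) (hz : 0 < z.im) : F (qq z) = 0 := by
  obtain ⟨f, hf⟩ : ∃ f : ℂ → ℂ, f = fun z => F (qq z) := ⟨_, rfl⟩
  have hfz : ∀ z, F (qq z) = f z := fun z => by rw [hf]
  simp only [hfz] at hW ⊢
  have fd : DifferentiableOn ℂ f {z | 0 < z.im} := hf ▸ comp_diff hF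
  have fT : ∀ z, f (z + 1) = f z := fun z => by rw [hf]; simp only [qq_add_one]
  have fT' : ∀ z, f (z - 1) = f z := fun z => by rw [← fT (z - 1), sub_add_cancel]
  have fS : ∀ z : ℂ, 0 < z.im → f (-1 / z) = z ^ 4 / 9 * f (z / 3) := fun z hz => by
    have := hW (z / 3) (by simpa using im_div_nat 3 0 (by norm_num) hz)
    rw [mul_div_cancel₀ z three_ne_zero] at this
    rw [this]; ring
  have d0 := comp_div_diff fd 3 0 (by norm_num)
  have d1 := comp_div_diff fd 3 1 (by norm_num)
  have d2 := comp_div_diff fd 3 2 (by norm_num)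
  have key := cusp_small2 4 (by norm_num)
    (fun z => f z * (f ((z + (0:ℕ)) / (3:ℕ)) *
      (f ((z + (1:ℕ)) / (3:ℕ)) * f ((z + (2:ℕ)) / (3:ℕ)))))
    (fd.mul (d0.mul (d1.mul d2))) ?_ ?_ ?_
  · rcases mul_zero_cases fd (d0.mul (d1.mul d2)) key with h | h
    · exact h z hz
    rcases mul_zero_cases d0 (d1.mul d2) h with h | h
    · exact zero_of_comp_div 3 0 (by norm_num) h z hz
    rcases mul_zero_cases d1 d2 h with h | h
    · exact zero_of_comp_div 3 1 (by norm_num) h z hz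
    · exact zero_of_comp_div 3 2 (by norm_num) h z hz
  · intro z hz
    have e : f ((z + 1 + (2:ℕ)) / (3:ℕ)) = f (z / 3) := by
      rw [← fT (z / 3)]; congr 1; push_cast; ring
    have e' : f ((z + 1 + (1:ℕ)) / (3:ℕ)) = f ((z + 2) / 3) := by
      congr 1; push_cast; ring
    simp only [e, e', fT]
    push_cast
    simp only [add_zero]
    ring
  · intro z hz
    have hz0 : z ≠ 0 := by rintro rfl; simp at hz
    have e0 : f ((-1 / z + (0:ℕ)) / (3:ℕ)) = 9 * z ^ 4 * f z := by
      rw [← hW z hz]; congr 1; push_cast; field_simp; ring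
    have e1 : f ((-1 / z + (1:ℕ)) / (3:ℕ)) = z ^ 4 * f ((z + 2) / 3) := by
      have hz1 : 0 < (z - 1).im := by simpa using hz
      have hz10 : z - 1 ≠ 0 := by intro h; rw [h] at hz1; simp at hz1
      have a1 := fS (z - 1) hz1
      have hy : 0 < (-1 / (z - 1) - 1 : ℂ).im := by simpa using im_S hz1
      have a2 := hW _ hy
      rw [fT', a1] at a2
      have c1 : (-1 / (z - 1) - 1 : ℂ) = -z / (z - 1) := by field_simp; ring
      have b1 : (-1 / (3 * (-1 / (z - 1) - 1)) : ℂ) = (-1 / z + (1:ℕ)) / (3:ℕ) := by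
        rw [c1]; push_cast; field_simp; ring
      have b2 : f ((z - 1) / 3) = f ((z + 2) / 3) := by
        rw [← fT ((z - 1) / 3)]; congr 1; ring
      rw [b1, b2] at a2
      rw [a2, c1]; field_simp
    have e2 : f ((-1 / z + (2:ℕ)) / (3:ℕ)) = z ^ 4 * f ((z + 1) / 3) := by
      have hz1 : 0 < (z + 1).im := by simpa using hz
      have hz10 : z + 1 ≠ 0 := by intro h; rw [h] at hz1; simp at hz1
      have a1 := fS (z + 1) hz1
      have hy : 0 < (-1 / (z + 1) + 1 : ℂ).im := by simpa using im_S hz1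
      have a2 := hW _ hy
      rw [fT, a1] at a2
      have c1 : (-1 / (z + 1) + 1 : ℂ) = z / (z + 1) := by field_simp; ring
      have b1 : (-1 / (3 * (-1 / (z + 1) + 1)) : ℂ) = (-1 / z + (2:ℕ)) / (3:ℕ) - 1 := by
        rw [c1]; push_cast; field_simp; ring
      rw [b1, fT'] at a2
      rw [a2, c1]; field_simp
    simp only [e0, e1, e2, fS z hz]
    push_cast
    simp only [add_zero]
    ring
  · have o0 := bigO_div hF h0 1 0 (by norm_num)
    have o1 := bigO_div hF h0 3 0 (by norm_num)
    have o2 := bigO_div hF h0 3 1 (by norm_num)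
    have o3 := bigO_div hF h0 3 2 (by norm_num)
    simp only [hfz] at o0 o1 o2 o3
    convert! o0.mul (o1.mul (o2.mul o3)) using 2 with z z
    · simp
    · simp only [← Real.exp_add]
      congr 1
      push_cast
      ring

theorem ball_pow_mem {x : ℂ} (n : ℕ) (hn : n ≠ 0) (hx : x ∈ Metric.ball (0:ℂ) 1) :
    x ^ n ∈ Metric.ball (0:ℂ) 1 := by
  rw [mem_ball_zero_iff] at *
  rw [norm_pow]
  exact pow_lt_one₀ (norm_nonneg _) hx hn

theorem comp_pow_diff {f : ℂ → ℂ} (hf : DifferentiableOn ℂ f (Metric.ball 0 1)) (n : ℕ)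
    (hn : n ≠ 0) : DifferentiableOn ℂ (fun x => f (x ^ n)) (Metric.ball 0 1) :=
  hf.comp (f := fun x : ℂ => x ^ n) (by fun_prop) fun _ hx => ball_pow_mem n hn hx

theorem comp_pow_hasDeriv {f f' : ℂ → ℂ}
    (hf : ∀ t : ℂ, 0 < t.im → HasDerivAt (fun t => f (qq t)) (cc * f' (qq t)) t) (n : ℕ)
    (hn : 0 < n) {t : ℂ} (ht : 0 < t.im) :
    HasDerivAt (fun t => f (qq t ^ n)) (n * cc * f' (qq t ^ n)) t := by
  have ht' : 0 < (n * t : ℂ).im := by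
    have : (0:ℝ) < n := by exact_mod_cast hn
    simp; positivity
  have h1 : HasDerivAt (fun t : ℂ => n * t) n t := by
    simpa using (hasDerivAt_id t).const_mul (n : ℂ)
  have := (hf _ ht').comp t h1
  simp only [qq_mul] at this
  convert! this using 1
  · funext t
    simp only [Function.comp, qq_mul]
  · ring

/-- The relation `E₄(q) + 4 E₄(q²) = 5 (2 E₂(q²) - E₂(q))²`. -/
theorem rel_two (z : ℂ) (hz : 0 < z.im) :
    qQ (qq z) + 4 * qQ (qq z ^ 2) - 5 * (2 * EisE2 (qq z ^ 2) - EisE2 (qq z)) ^ 2 = 0 := by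
  refine level_two
    (F := fun x => qQ x + 4 * qQ (x ^ 2) - 5 * (2 * EisE2 (x ^ 2) - EisE2 x) ^ 2) ?_ ?_ ?_ z hz
  · exact (qQ_diff.add ((comp_pow_diff qQ_diff 2 two_ne_zero).const_mul 4)).sub
      (((((comp_pow_diff eisE2_diff 2 two_ne_zero).const_mul 2).sub eisE2_diff).pow 2).const_mul 5)
  · norm_num [qQ_zero, eisE2_zero]
  · intro z hz
    have hz0 : z ≠ 0 := by rintro rfl; simp at hz
    have hz2 : 0 < (2 * z).im := by simpa using hz
    have e1 : qq (2 * z) = qq z ^ 2 := by exact_mod_cast qq_mul 2 z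
    have e2 : qq (-1 / (2 * z)) ^ 2 = qq (-1 / z) := by
      rw [← qq_mul]; congr 1; push_cast; field_simp
    simp only [e2, Q_S z hz, eisE2_S z hz, Q_S _ hz2, eisE2_S _ hz2, e1]
    ring

/-- The relation `2 E₄(q) + 18 E₄(q³) = 5 (3 E₂(q³) - E₂(q))²`. -/
theorem rel_three (z : ℂ) (hz : 0 < z.im) :
    qQ (qq z) + 9 * qQ (qq z ^ 3) - 5 / 2 * (3 * EisE2 (qq z ^ 3) - EisE2 (qq z)) ^ 2 = 0 := by
  refine level_three
    (F := fun x => qQ x + 9 * qQ (x ^ 3) - 5 / 2 * (3 * EisE2 (x ^ 3) - EisE2 x) ^ 2) ?_ ?_ ?_ z hz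
  · exact (qQ_diff.add ((comp_pow_diff qQ_diff 3 three_ne_zero).const_mul 9)).sub
      (((((comp_pow_diff eisE2_diff 3 three_ne_zero).const_mul 3).sub eisE2_diff).pow 2).const_mul
        (5 / 2))
  · norm_num [qQ_zero, eisE2_zero]
  · intro z hz
    have hz0 : z ≠ 0 := by rintro rfl; simp at hz
    have hz2 : 0 < (3 * z).im := by simpa using hz
    have e1 : qq (3 * z) = qq z ^ 3 := by exact_mod_cast qq_mul 3 z
    have e2 : qq (-1 / (3 * z)) ^ 3 = qq (-1 / z) := by
      rw [← qq_mul]; congr 1; push_cast; field_simp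
    simp only [e2, Q_S z hz, eisE2_S z hz, Q_S _ hz2, eisE2_S _ hz2, e1]
    ring

theorem deriv_eventually {u u1 : ℂ → ℂ} (h : ∀ t : ℂ, 0 < t.im → HasDerivAt u (u1 t) t) {t : ℂ}
    (ht : 0 < t.im) : deriv u =ᶠ[nhds t] u1 := by
  filter_upwards [uhp_open.mem_nhds ht] with w hw
  exact (h w hw).deriv

theorem derivs_eq {u u1 u2 u3 : ℂ → ℂ} (h1 : ∀ t : ℂ, 0 < t.im → HasDerivAt u (u1 t) t)
    (h2 : ∀ t : ℂ, 0 < t.im → HasDerivAt u1 (u2 t) t)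
    (h3 : ∀ t : ℂ, 0 < t.im → HasDerivAt u2 (u3 t) t) (t : ℂ) (ht : 0 < t.im) :
    deriv u t = u1 t ∧ deriv (deriv u) t = u2 t ∧ deriv (deriv (deriv u)) t = u3 t := by
  have e1 : ∀ t : ℂ, 0 < t.im → deriv u =ᶠ[nhds t] u1 := fun t ht => deriv_eventually h1 ht
  have k2 : ∀ t : ℂ, 0 < t.im → HasDerivAt (deriv u) (u2 t) t :=
    fun t ht => (h2 t ht).congr_of_eventuallyEq (e1 t ht)
  have k3 : ∀ t : ℂ, 0 < t.im → HasDerivAt (deriv (deriv u)) (u3 t) t :=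
    fun t ht => (h3 t ht).congr_of_eventuallyEq (deriv_eventually k2 ht)
  exact ⟨(h1 t ht).deriv, (k2 t ht).deriv, (k3 t ht).deriv⟩

theorem hasDeriv_zero {f : ℂ → ℂ} {f' t : ℂ} (h : ∀ t : ℂ, 0 < t.im → f t = 0) (ht : 0 < t.im)
    (hf : HasDerivAt f f' t) : f' = 0 := by
  have h1 : f =ᶠ[nhds t] fun _ => 0 := by
    filter_upwards [uhp_open.mem_nhds ht] with w hw
    exact h w hw
  exact (hf.congr_of_eventuallyEq h1.symm).unique (hasDerivAt_const t (0:ℂ)) |>.symm ▸ rfl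

/-- The differential algebra: derivatives of `u = 2πi (P + m p) / 24` and the differential
consequences of a relation `Q + m² q = K (m p - P)²`. -/
theorem system (m K : ℂ) (P Q R p q r : ℂ → ℂ)
    (hP : ∀ t : ℂ, 0 < t.im → HasDerivAt P (cc * ((P t ^ 2 - Q t) / 12)) t)
    (hQ : ∀ t : ℂ, 0 < t.im → HasDerivAt Q (cc * ((P t * Q t - R t) / 3)) t)
    (hR : ∀ t : ℂ, 0 < t.im → HasDerivAt R (cc * ((P t * R t - Q t ^ 2) / 2)) t)
    (hp : ∀ t : ℂ, 0 < t.im → HasDerivAt p (m * cc * ((p t ^ 2 - q t) / 12)) t)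
    (hq : ∀ t : ℂ, 0 < t.im → HasDerivAt q (m * cc * ((p t * q t - r t) / 3)) t)
    (hr : ∀ t : ℂ, 0 < t.im → HasDerivAt r (m * cc * ((p t * r t - q t ^ 2) / 2)) t)
    (hf : ∀ t : ℂ, 0 < t.im → Q t + m ^ 2 * q t - K * (m * p t - P t) ^ 2 = 0)
    (u : ℂ → ℂ) (hu : ∀ t, u t = cc / 24 * (P t + m * p t)) (t : ℂ) (ht : 0 < t.im) :
    deriv u t = cc ^ 2 / 288 * ((P t ^ 2 - Q t) + m ^ 2 * (p t ^ 2 - q t)) ∧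
    deriv (deriv u) t = cc ^ 3 / 1728 * ((P t ^ 3 - 3 * P t * Q t + 2 * R t)
      + m ^ 3 * (p t ^ 3 - 3 * p t * q t + 2 * r t)) ∧
    deriv (deriv (deriv u)) t = cc ^ 4 / 6912 *
      ((P t ^ 4 - 6 * P t ^ 2 * Q t + 8 * P t * R t - 3 * Q t ^ 2)
      + m ^ 4 * (p t ^ 4 - 6 * p t ^ 2 * q t + 8 * p t * r t - 3 * q t ^ 2)) ∧
    2 * (P t * Q t - R t) + 2 * m ^ 3 * (p t * q t - r t)
      - K * (m * p t - P t) * (m ^ 2 * (p t ^ 2 - q t) - (P t ^ 2 - Q t)) = 0 ∧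
    2 * ((P t ^ 2 - Q t) * Q t / 12 + P t * (P t * Q t - R t) / 3 - (P t * R t - Q t ^ 2) / 2)
      + 2 * m ^ 4 * ((p t ^ 2 - q t) * q t / 12 + p t * (p t * q t - r t) / 3
        - (p t * r t - q t ^ 2) / 2)
      - K * ((m ^ 2 * (p t ^ 2 - q t) - (P t ^ 2 - Q t)) ^ 2 / 12
        + (m * p t - P t) * (m ^ 3 * (p t ^ 3 - 3 * p t * q t + 2 * r t)
          - (P t ^ 3 - 3 * P t * Q t + 2 * R t)) / 6) = 0 := by
  have hc := cc_ne
  have hu' : u = fun t => cc / 24 * (P t + m * p t) := funext hu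
  obtain ⟨h1, h2, h3⟩ := derivs_eq (u := u)
    (u1 := fun t => cc ^ 2 / 288 * ((P t ^ 2 - Q t) + m ^ 2 * (p t ^ 2 - q t)))
    (u2 := fun t => cc ^ 3 / 1728 * ((P t ^ 3 - 3 * (P t * Q t) + 2 * R t)
      + m ^ 3 * (p t ^ 3 - 3 * (p t * q t) + 2 * r t)))
    (u3 := fun t => cc ^ 4 / 6912 *
      ((P t ^ 4 - 6 * P t ^ 2 * Q t + 8 * P t * R t - 3 * Q t ^ 2)
      + m ^ 4 * (p t ^ 4 - 6 * p t ^ 2 * q t + 8 * p t * r t - 3 * q t ^ 2)))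
    (fun t ht => by
      rw [hu']
      have := ((hP t ht).fun_add ((hp t ht).const_mul m)).const_mul (cc / 24)
      refine this.congr_deriv ?_
      ring)
    (fun t ht => by
      have := ((((hP t ht).fun_pow 2).fun_sub (hQ t ht)).fun_add
        ((((hp t ht).fun_pow 2).fun_sub (hq t ht)).const_mul (m ^ 2))).const_mul (cc ^ 2 / 288)
      refine this.congr_deriv ?_
      push_cast
      ring)
    (fun t ht => by
      have := (((((hP t ht).fun_pow 3).fun_sub (((hP t ht).fun_mul (hQ t ht)).const_mul 3)).fun_add
        ((hR t ht).const_mul 2)).fun_add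
        (((((hp t ht).fun_pow 3).fun_sub (((hp t ht).fun_mul (hq t ht)).const_mul 3)).fun_add
        ((hr t ht).const_mul 2)).const_mul (m ^ 3))).const_mul (cc ^ 3 / 1728)
      refine this.congr_deriv ?_
      push_cast
      ring) t ht
  have g1 : ∀ t : ℂ, 0 < t.im → 2 * (P t * Q t - R t) + 2 * m ^ 3 * (p t * q t - r t)
      - K * ((m * p t - P t) * (m ^ 2 * (p t ^ 2 - q t) - (P t ^ 2 - Q t))) = 0 := by
    intro t ht
    have := ((hQ t ht).fun_add ((hq t ht).const_mul (m ^ 2))).fun_sub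
      (((((hp t ht).const_mul m).fun_sub (hP t ht)).fun_pow 2).const_mul K)
    have h0 := hasDeriv_zero hf ht this
    apply mul_left_cancel₀ hc
    push_cast at h0
    linear_combination 6 * h0
  have g2 : _ = _ := hasDeriv_zero g1 ht
    (((((hP t ht).fun_mul (hQ t ht)).fun_sub (hR t ht)).const_mul 2).fun_add
      ((((hp t ht).fun_mul (hq t ht)).fun_sub (hr t ht)).const_mul (2 * m ^ 3)) |>.fun_sub
      (((((hp t ht).const_mul m).fun_sub (hP t ht)).fun_mul
        (((((hp t ht).fun_pow 2).fun_sub (hq t ht)).const_mul (m ^ 2)).fun_sub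
          (((hP t ht).fun_pow 2).fun_sub (hQ t ht)))).const_mul K))
  refine ⟨h1, ?_, h3, ?_, ?_⟩
  · rw [h2]; ring
  · rw [← g1 t ht]; ring
  · apply mul_left_cancel₀ hc
    push_cast at g2
    linear_combination g2

theorem chazy_of_pow (n : ℕ) (hn : 0 < n) (K : ℂ)
    (hf : ∀ t : ℂ, 0 < t.im → qQ (qq t) + (n : ℂ) ^ 2 * qQ (qq t ^ n)
      - K * (n * EisE2 (qq t ^ n) - EisE2 (qq t)) ^ 2 = 0)
    (u : ℂ → ℂ) (hu : ∀ t, u t = cc / 24 * (EisE2 (qq t) + n * EisE2 (qq t ^ n)))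
    (t : ℂ) (ht : 0 < t.im) :
    deriv u t = cc ^ 2 / 288 * ((EisE2 (qq t) ^ 2 - qQ (qq t)) + (n : ℂ) ^ 2 * (EisE2 (qq t ^ n) ^ 2 - qQ (qq t ^ n))) ∧
    deriv (deriv u) t = cc ^ 3 / 1728 * ((EisE2 (qq t) ^ 3 - 3 * EisE2 (qq t) * qQ (qq t) + 2 * qR (qq t))
      + (n : ℂ) ^ 3 * (EisE2 (qq t ^ n) ^ 3 - 3 * EisE2 (qq t ^ n) * qQ (qq t ^ n) + 2 * qR (qq t ^ n))) ∧
    deriv (deriv (deriv u)) t = cc ^ 4 / 6912 *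
      ((EisE2 (qq t) ^ 4 - 6 * EisE2 (qq t) ^ 2 * qQ (qq t) + 8 * EisE2 (qq t) * qR (qq t) - 3 * qQ (qq t) ^ 2)
      + (n : ℂ) ^ 4 * (EisE2 (qq t ^ n) ^ 4 - 6 * EisE2 (qq t ^ n) ^ 2 * qQ (qq t ^ n) + 8 * EisE2 (qq t ^ n) * qR (qq t ^ n) - 3 * qQ (qq t ^ n) ^ 2)) ∧
    2 * (EisE2 (qq t) * qQ (qq t) - qR (qq t)) + 2 * (n : ℂ) ^ 3 * (EisE2 (qq t ^ n) * qQ (qq t ^ n) - qR (qq t ^ n))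
      - K * (n * EisE2 (qq t ^ n) - EisE2 (qq t)) * ((n : ℂ) ^ 2 * (EisE2 (qq t ^ n) ^ 2 - qQ (qq t ^ n)) - (EisE2 (qq t) ^ 2 - qQ (qq t))) = 0 ∧
    2 * ((EisE2 (qq t) ^ 2 - qQ (qq t)) * qQ (qq t) / 12 + EisE2 (qq t) * (EisE2 (qq t) * qQ (qq t) - qR (qq t)) / 3 - (EisE2 (qq t) * qR (qq t) - qQ (qq t) ^ 2) / 2)
      + 2 * (n : ℂ) ^ 4 * ((EisE2 (qq t ^ n) ^ 2 - qQ (qq t ^ n)) * qQ (qq t ^ n) / 12 + EisE2 (qq t ^ n) * (EisE2 (qq t ^ n) * qQ (qq t ^ n) - qR (qq t ^ n)) / 3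
        - (EisE2 (qq t ^ n) * qR (qq t ^ n) - qQ (qq t ^ n) ^ 2) / 2)
      - K * (((n : ℂ) ^ 2 * (EisE2 (qq t ^ n) ^ 2 - qQ (qq t ^ n)) - (EisE2 (qq t) ^ 2 - qQ (qq t))) ^ 2 / 12
        + (n * EisE2 (qq t ^ n) - EisE2 (qq t)) * ((n : ℂ) ^ 3 * (EisE2 (qq t ^ n) ^ 3 - 3 * EisE2 (qq t ^ n) * qQ (qq t ^ n) + 2 * qR (qq t ^ n))
          - (EisE2 (qq t) ^ 3 - 3 * EisE2 (qq t) * qQ (qq t) + 2 * qR (qq t))) / 6) = 0 :=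
  system n K (fun t => EisE2 (qq t)) (fun t => qQ (qq t)) (fun t => qR (qq t))
    (fun t => EisE2 (qq t ^ n)) (fun t => qQ (qq t ^ n)) (fun t => qR (qq t ^ n))
    (fun _ h => P_hasDeriv h) (fun _ h => Q_hasDeriv h) (fun _ h => R_hasDeriv h)
    (fun _ h => comp_pow_hasDeriv (f' := fun x => (EisE2 x ^ 2 - qQ x) / 12)
      (fun _ h => P_hasDeriv h) n hn h)
    (fun _ h => comp_pow_hasDeriv (f' := fun x => (EisE2 x * qQ x - qR x) / 3)
      (fun _ h => Q_hasDeriv h) n hn h)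
    (fun _ h => comp_pow_hasDeriv (f' := fun x => (EisE2 x * qR x - qQ x ^ 2) / 2)
      (fun _ h => R_hasDeriv h) n hn h)
    hf u hu t ht

theorem generalized_chazy_fricke_groups (τ : ℂ) (hτ : 0 < τ.im) :
    (2 * chazyU4 (fun t => (Real.pi : ℂ) * Complex.I / 4 * E8sig t) τ *
        chazyU8 (fun t => (Real.pi : ℂ) * Complex.I / 4 * E8sig t) τ -
      chazyU6 (fun t => (Real.pi : ℂ) * Complex.I / 4 * E8sig t) τ ^ 2 +
      32 * chazyU4 (fun t => (Real.pi : ℂ) * Complex.I / 4 * E8sig t) τ ^ 3 = 0) ∧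
    (4 * chazyU4 (fun t => (Real.pi : ℂ) * Complex.I / 3 * E6sig t) τ *
        chazyU8 (fun t => (Real.pi : ℂ) * Complex.I / 3 * E6sig t) τ -
      3 * chazyU6 (fun t => (Real.pi : ℂ) * Complex.I / 3 * E6sig t) τ ^ 2 +
      48 * chazyU4 (fun t => (Real.pi : ℂ) * Complex.I / 3 * E6sig t) τ ^ 3 = 0) := by
  constructor
  · have hu : ∀ t, (fun t => (Real.pi : ℂ) * Complex.I / 4 * E8sig t) t
        = cc / 24 * (EisE2 (qq t) + (2 : ℕ) * EisE2 (qq t ^ 2)) := by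
      intro t; simp only [E8sig, cc]; push_cast; ring
    have hf := rel_two τ hτ
    obtain ⟨h1, h2, h3, g1, g2⟩ := chazy_of_pow 2 two_pos 5
      (fun t ht => by rw [← rel_two t ht]; push_cast; ring) _ hu τ hτ
    have h0 := hu τ
    simp only [chazyU4, chazyU6, chazyU8]
    beta_reduce at h0
    rw [h1, h2, h3, h0]
    clear h0 h1 h2 h3 hu
    push_cast at *
    generalize EisE2 (qq τ) = P at *
    generalize EisE2 (qq τ ^ 2) = p at *
    generalize qQ (qq τ) = Q at *
    generalize qQ (qq τ ^ 2) = q at *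
    generalize qR (qq τ) = R at *
    generalize qR (qq τ ^ 2) = r at *
    have hQ : Q = 5 * (2 * p - P) ^ 2 - 4 * q := by linear_combination hf
    have hR : R = P * Q + 8 * (p * q - r)
      - 5 / 2 * (2 * p - P) * (4 * (p ^ 2 - q) - (P ^ 2 - Q)) := by linear_combination - g1 / 2
    subst hR hQ
    linear_combination (1 / 2160 * cc ^ 6 * ((P - 2 * p) ^ 2 / 64)) * g2
  · have hu : ∀ t, (fun t => (Real.pi : ℂ) * Complex.I / 3 * E6sig t) t
        = cc / 24 * (EisE2 (qq t) + (3 : ℕ) * EisE2 (qq t ^ 3)) := by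
      intro t; simp only [E6sig, cc]; push_cast; ring
    have hf := rel_three τ hτ
    obtain ⟨h1, h2, h3, g1, g2⟩ := chazy_of_pow 3 three_pos (5 / 2)
      (fun t ht => by rw [← rel_three t ht]; push_cast; ring) _ hu τ hτ
    have h0 := hu τ
    simp only [chazyU4, chazyU6, chazyU8]
    beta_reduce at h0
    rw [h1, h2, h3, h0]
    clear h0 h1 h2 h3 hu
    push_cast at *
    generalize EisE2 (qq τ) = P at *
    generalize EisE2 (qq τ ^ 3) = p at *
    generalize qQ (qq τ) = Q at *
    generalize qQ (qq τ ^ 3) = q at *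
    generalize qR (qq τ) = R at *
    generalize qR (qq τ ^ 3) = r at *
    have hQ : Q = 5 / 2 * (3 * p - P) ^ 2 - 9 * q := by linear_combination hf
    have hR : R = P * Q + 27 * (p * q - r)
      - 5 / 4 * (3 * p - P) * (9 * (p ^ 2 - q) - (P ^ 2 - Q)) := by linear_combination - g1 / 2
    subst hR hQ
    linear_combination (1 / 720 * cc ^ 6 * ((P - 3 * p) ^ 2 / 144)) * g2
end
end
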